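/- For every real α with 0 < α ≤ 2 and every x in [0,1], the α-Rényi binary entropy satisfies Hₐᴿ(x) ≤ (ln 2)^(1-α/2) · (H₂ᴿ(x))^(α/2). -/

import Mathlib

/-- The `α`-Rényi binary entropy; for `α = 1` it is the Shannon binary entropy. -/
noncomputable def renyiBin (α x : ℝ) : ℝ :=
  if α = 1 then -(x * Real.log x) - (1 - x) * Real.log (1 - x)
  else Real.log (x ^ α + (1 - x) ^ α) / (1 - α)

open Real Set Filter Topology

noncomputable def rbh (u : ℝ) : ℝ := Real.log (1 + Real.exp (-u))
noncomputable def rbs (u : ℝ) : ℝ := (1 + Real.exp u)⁻¹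

lemma rbh_zero : rbh 0 = Real.log 2 := by
  simp [rbh]; norm_num

lemma rbs_pos (u : ℝ) : 0 < rbs u := by unfold rbs; positivity

lemma rbs_lt_one (u : ℝ) : rbs u < 1 := by
  unfold rbs
  apply inv_lt_one_of_one_lt₀
  linarith [Real.exp_pos u]

lemma rbs_anti : StrictAnti rbs := by
  intro a b hab
  unfold rbs
  have := Real.exp_lt_exp.2 hab
  have := Real.exp_pos a
  exact inv_strictAnti₀ (by linarith) (by linarith)

lemma rbh_pos (u : ℝ) : 0 < rbh u := by
  unfold rbh
  exact Real.log_pos (by linarith [Real.exp_pos (-u)])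

lemma rbh_anti : StrictAnti rbh := by
  intro a b hab
  unfold rbh
  have h1 : Real.exp (-b) < Real.exp (-a) := Real.exp_lt_exp.2 (by linarith)
  have := Real.exp_pos (-b)
  exact Real.log_lt_log (by linarith) (by linarith)

lemma rbh_deriv (u : ℝ) : HasDerivAt rbh (-rbs u) u := by
  have h1 : HasDerivAt (fun u : ℝ => 1 + Real.exp (-u)) (Real.exp (-u) * (-1)) u :=
    ((hasDerivAt_neg u).exp).const_add 1
  have h2 : HasDerivAt rbh _ u := h1.log (by positivity)
  refine h2.congr_deriv ?_
  unfold rbs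
  have := Real.exp_pos u
  rw [Real.exp_neg]
  field_simp
  ring

lemma rbs_deriv (u : ℝ) : HasDerivAt rbs (-(rbs u * (1 - rbs u))) u := by
  have h1 : HasDerivAt (fun u : ℝ => 1 + Real.exp u) (Real.exp u) u :=
    (Real.hasDerivAt_exp u).const_add 1
  have h2 : HasDerivAt rbs _ u := h1.inv (by positivity)
  refine h2.congr_deriv ?_
  unfold rbs
  have := Real.exp_pos u
  field_simp
  ring

/-- The key one-variable fact: `log 2 * (s u - s (2u)) ≤ (1/2 - s u) * (2 h u - h (2u))`. -/
lemma rb_key (u : ℝ) (hu : 0 ≤ u) :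
    Real.log 2 * (rbs u - rbs (2 * u)) ≤ (1 / 2 - rbs u) * (2 * rbh u - rbh (2 * u)) := by
  set y := Real.exp (-u) with hy
  have hy0 : 0 < y := Real.exp_pos _
  have hy1 : y ≤ 1 := by rw [hy]; exact Real.exp_le_one_iff.2 (by linarith)
  have e1 : Real.exp u = y⁻¹ := by rw [hy, Real.exp_neg, inv_inv]
  have e2 : Real.exp (2 * u) = (y⁻¹) ^ 2 := by
    rw [← e1, ← Real.exp_nat_mul]; norm_num
  have e3 : Real.exp (-(2 * u)) = y ^ 2 := by
    rw [hy, ← Real.exp_nat_mul]; congr 1; push_cast; ring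
  have hs1 : rbs u = y / (1 + y) := by
    unfold rbs; rw [e1]; field_simp; ring
  have hs2 : rbs (2 * u) = y ^ 2 / (1 + y ^ 2) := by
    unfold rbs; rw [e2]; field_simp; ring
  set z := 2 * y / (1 + y ^ 2) with hz
  have hz0 : 0 ≤ z := by positivity
  have hz1 : z ≤ 1 := by
    rw [hz, div_le_one (by positivity)]; nlinarith [sq_nonneg (y - 1)]
  have hH : 2 * rbh u - rbh (2 * u) = Real.log (1 + z) := by
    unfold rbh
    rw [e3, ← hy]
    have : 1 + z = (1 + y) ^ 2 / (1 + y ^ 2) := by rw [hz]; field_simp; ring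
    rw [this, Real.log_div (by positivity) (by positivity), Real.log_pow]
    norm_num
  have hlog : z * Real.log 2 ≤ Real.log (1 + z) := by
    have hc := strictConcaveOn_log_Ioi.concaveOn.2 (show (1:ℝ) ∈ Ioi 0 by simp)
      (show (2:ℝ) ∈ Ioi 0 by simp) (show 0 ≤ 1 - z by linarith) hz0 (by ring)
    simp only [smul_eq_mul, Real.log_one, mul_zero, zero_add] at hc
    have he : 1 + z = (1 - z) * 1 + z * 2 := by ring
    rw [he]
    exact hc
  rw [hH, hs1, hs2]
  have hh : (1:ℝ) / 2 - y / (1 + y) = (1 - y) / (2 * (1 + y)) := by field_simp; ring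
  have hd : y / (1 + y) - y ^ 2 / (1 + y ^ 2) = (1 - y) / (2 * (1 + y)) * z := by
    rw [hz]; field_simp; ring
  rw [hh, hd]
  have : 0 ≤ (1 - y) / (2 * (1 + y)) := div_nonneg (by linarith) (by positivity)
  nlinarith [mul_le_mul_of_nonneg_left hlog this]

lemma rbQ_pos (u : ℝ) (hu : 0 ≤ u) : 0 < 2 * rbh u - rbh (2 * u) := by
  have := rbh_pos u
  have := rbh_anti.antitone (show u ≤ 2 * u by linarith)
  linarith

noncomputable def rbK (u r v : ℝ) : ℝ := rbs v - rbs u - r * rbh v + r * rbh u / u * v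

lemma rbK_d1 (u r v : ℝ) : HasDerivAt (rbK u r)
    (-(rbs v * (1 - rbs v)) + r * rbs v + r * rbh u / u) v := by
  have h : HasDerivAt (rbK u r) _ v := (((rbs_deriv v).sub_const (rbs u)).sub ((rbh_deriv v).const_mul r)).add
    ((hasDerivAt_id v).const_mul (r * rbh u / u))
  refine h.congr_deriv ?_
  ring

lemma rbK_d2 (u r v : ℝ) : HasDerivAt
    (fun v => -(rbs v * (1 - rbs v)) + r * rbs v + r * rbh u / u)
    (rbs v * (1 - rbs v) * (1 - 2 * rbs v - r)) v := by
  have hs := rbs_deriv v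
  have h : HasDerivAt (fun v => -(rbs v * (1 - rbs v)) + r * rbs v + r * rbh u / u) _ v :=
    (((hs.mul (hs.const_sub 1)).neg).add (hs.const_mul r)).add_const (r * rbh u / u)
  refine h.congr_deriv ?_
  ring

lemma rbK_deriv2 (u r v : ℝ) :
    deriv^[2] (rbK u r) v = rbs v * (1 - rbs v) * (1 - 2 * rbs v - r) := by
  have : deriv (rbK u r) = fun v => -(rbs v * (1 - rbs v)) + r * rbs v + r * rbh u / u := by
    ext w; exact (rbK_d1 u r w).deriv
  simp only [Function.iterate_succ, Function.iterate_zero, Function.comp, id]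
  rw [this]
  exact (rbK_d2 u r v).deriv

/-- A function that is concave then convex, with nonneg value at `0` and zeros `u`, `2u`. -/
lemma rb_sign (u c : ℝ) (f : ℝ → ℝ) (hu : 0 < u) (hc0 : 0 ≤ c) (hcu : c ≤ u)
    (hcc : ConcaveOn ℝ (Icc 0 c) f) (hcv : ConvexOn ℝ (Ici c) f)
    (h0 : 0 ≤ f 0) (h1 : f u = 0) (h2 : f (2 * u) = 0) :
    (∀ v, 0 ≤ v → v ≤ u → 0 ≤ f v) ∧ (∀ v, u ≤ v → v ≤ 2 * u → f v ≤ 0) := by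
  have hA : ∀ v, c ≤ v → v ≤ u → 0 ≤ f v := by
    intro v hv hvu
    have h := hcv.2 (show v ∈ Ici c from hv) (show 2 * u ∈ Ici c from mem_Ici.2 (by linarith))
      (show 0 ≤ u / (2 * u - v) from div_nonneg (by linarith) (by linarith))
      (show 0 ≤ (u - v) / (2 * u - v) from div_nonneg (by linarith) (by linarith))
      (by have : 2 * u - v ≠ 0 := by linarith
          rw [← add_div, div_eq_one_iff_eq this]; ring)
    have he : (u / (2 * u - v)) • v + ((u - v) / (2 * u - v)) • (2 * u) = u := by
      have : 2 * u - v ≠ 0 := by linarith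
      simp only [smul_eq_mul]
      rw [div_mul_eq_mul_div, div_mul_eq_mul_div, ← add_div, div_eq_iff this]; ring
    rw [he, h1, h2] at h
    simp only [smul_eq_mul, mul_zero, add_zero] at h
    have hp : 0 < u / (2 * u - v) := div_pos hu (by linarith)
    exact nonneg_of_mul_nonneg_right h hp
  refine ⟨?_, ?_⟩
  · intro v hv hvu
    rcases le_total c v with h | h
    · exact hA v h hvu
    · have hm := hcc.min_le_of_mem_Icc (x := 0) (y := c) (z := v) ⟨le_rfl, hc0⟩ ⟨hc0, le_rfl⟩ ⟨hv, h⟩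
      exact (le_min h0 (hA c le_rfl hcu)).trans hm
  · intro v hv hvu
    have hm := hcv.le_max_of_mem_Icc (x := u) (y := 2 * u) (z := v) hcu
      (show c ≤ 2 * u by linarith) ⟨hv, hvu⟩
    rw [h1, h2] at hm
    simpa using hm

lemma rbK_sign (u r : ℝ) (hu : 0 < u)
    (hr : r * (2 * rbh u - rbh (2 * u)) = rbs u - rbs (2 * u)) :
    (∀ v, 0 ≤ v → v ≤ u → 0 ≤ rbK u r v) ∧ (∀ v, u ≤ v → v ≤ 2 * u → rbK u r v ≤ 0) := by
  have hQ := rbQ_pos u hu.le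
  have hkey := rb_key u hu.le
  have hs0 : rbs 0 = 1 / 2 := by simp [rbs]; norm_num
  have hr1 : Real.log 2 * r ≤ 1 / 2 - rbs u := by
    rw [← hr] at hkey
    refine le_of_mul_le_mul_right ?_ hQ
    linarith
  have hl2 : (1:ℝ) / 2 < Real.log 2 := by linarith [Real.log_two_gt_d9]
  have hr0 : 0 ≤ r := by
    have h := rbs_anti.antitone (show u ≤ 2 * u by linarith)
    refine nonneg_of_mul_nonneg_left (b := 2 * rbh u - rbh (2 * u)) ?_ hQ
    linarith
  have hr2 : r ≤ 1 - 2 * rbs u := by nlinarith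
  have hcont : Continuous rbs := continuous_iff_continuousAt.2 fun x => (rbs_deriv x).continuousAt
  obtain ⟨c, ⟨hc0, hcu⟩, hc⟩ : ∃ c ∈ Icc 0 u, 1 - 2 * rbs c = r := by
    have h := intermediate_value_Icc hu.le
      (f := fun c => 1 - 2 * rbs c) (by fun_prop)
    exact h ⟨by simp only [hs0]; linarith, hr2⟩
  have hKc : Continuous (rbK u r) :=
    continuous_iff_continuousAt.2 fun x => (rbK_d1 u r x).continuousAt
  have hKd : Differentiable ℝ (rbK u r) := fun x => (rbK_d1 u r x).differentiableAt
  have hKd' : Differentiable ℝ (deriv (rbK u r)) := by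
    have : deriv (rbK u r) = fun v => -(rbs v * (1 - rbs v)) + r * rbs v + r * rbh u / u := by
      ext w; exact (rbK_d1 u r w).deriv
    rw [this]
    exact fun x => (rbK_d2 u r x).differentiableAt
  apply rb_sign u c (rbK u r) hu hc0 hcu
  · apply concaveOn_of_deriv2_nonpos (convex_Icc 0 c) hKc.continuousOn hKd.differentiableOn
      hKd'.differentiableOn
    intro x hx
    rw [interior_Icc] at hx
    rw [rbK_deriv2]
    have h1 := rbs_anti.antitone hx.2.le
    have h2 := rbs_pos x
    have h3 := rbs_lt_one x
    exact mul_nonpos_of_nonneg_of_nonpos (mul_nonneg h2.le (by linarith)) (by linarith)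
  · apply convexOn_of_deriv2_nonneg (convex_Ici c) hKc.continuousOn hKd.differentiableOn
      hKd'.differentiableOn
    intro x hx
    rw [interior_Ici] at hx
    rw [rbK_deriv2]
    have h1 := rbs_anti.antitone (le_of_lt hx)
    have h2 := rbs_pos x
    have h3 := rbs_lt_one x
    exact mul_nonneg (mul_nonneg h2.le (by linarith)) (by linarith)
  · unfold rbK
    rw [hs0, rbh_zero]
    linarith
  · unfold rbK
    field_simp
    ring
  · unfold rbK
    have : r * rbh u / u * (2 * u) = 2 * (r * rbh u) := by field_simp
    rw [this]
    linarith

lemma rbP_pos (a u : ℝ) (ha0 : 0 < a) (ha1 : a ≠ 1) (hu : 0 ≤ u) :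
    0 < (rbh (a * u) - a * rbh u) / (1 - a) := by
  have hp := rbh_pos u
  rcases lt_or_gt_of_ne ha1 with h | h
  · have := rbh_anti.antitone (show a * u ≤ u by nlinarith)
    exact div_pos (by nlinarith) (by linarith)
  · have := rbh_anti.antitone (show u ≤ a * u by nlinarith)
    exact div_pos_of_neg_of_neg (by nlinarith) (by linarith)

lemma rb_mono (a : ℝ) (ha0 : 0 < a) (ha2 : a ≤ 2) (ha1 : a ≠ 1) :
    MonotoneOn (fun u => a / 2 * Real.log (2 * rbh u - rbh (2 * u))
      - Real.log ((rbh (a * u) - a * rbh u) / (1 - a))) (Ici 0) := by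
  have ha1' : 1 - a ≠ 0 := sub_ne_zero.2 (Ne.symm ha1)
  have hmul : ∀ b u : ℝ, HasDerivAt (fun u => rbh (b * u)) (-rbs (b * u) * b) u := by
    intro b u
    have h1 : HasDerivAt (fun u : ℝ => b * u) b u := by
      simpa using (hasDerivAt_id u).const_mul b
    exact HasDerivAt.comp (h₂ := rbh) u (rbh_deriv (b * u)) h1
  have hd : ∀ u : ℝ, 0 ≤ u → HasDerivAt (fun u => a / 2 * Real.log (2 * rbh u - rbh (2 * u))
      - Real.log ((rbh (a * u) - a * rbh u) / (1 - a)))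
      (a / 2 * ((2 * -rbs u - -rbs (2 * u) * 2) / (2 * rbh u - rbh (2 * u)))
       - ((-rbs (a * u) * a - a * -rbs u) / (1 - a)) / ((rbh (a * u) - a * rbh u) / (1 - a))) u := by
    intro u hu
    have hQ := ((((rbh_deriv u).const_mul 2).sub (hmul 2 u)).log (rbQ_pos u hu).ne').const_mul (a / 2)
    have hP := ((((hmul a u).sub ((rbh_deriv u).const_mul a)).div_const (1 - a)).log
      (rbP_pos a u ha0 ha1 hu).ne')
    exact hQ.sub hP
  apply monotoneOn_of_deriv_nonneg (convex_Ici 0)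
  · exact fun u hu => (hd u hu).continuousAt.continuousWithinAt
  · intro u hu
    rw [interior_Ici] at hu
    exact (hd u (le_of_lt hu)).differentiableAt.differentiableWithinAt
  · intro u hu
    rw [interior_Ici] at hu
    have hu : 0 < u := hu
    rw [(hd u hu.le).deriv]
    have hQ := rbQ_pos u hu.le
    have hP := rbP_pos a u ha0 ha1 hu.le
    set r := (rbs u - rbs (2 * u)) / (2 * rbh u - rbh (2 * u)) with hr
    have hK := rbK_sign u r hu (by rw [hr]; field_simp)
    set p := rbh (a * u) - a * rbh u with hp
    have hp0 : p ≠ 0 := by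
      intro h; rw [h] at hP; simp at hP
    have hKe : rbK u r (a * u) = rbs (a * u) - rbs u - r * p := by
      unfold rbK; rw [hp]; field_simp; ring
    have hexp : (a / 2 * ((2 * -rbs u - -rbs (2 * u) * 2) / (2 * rbh u - rbh (2 * u)))
       - ((-rbs (a * u) * a - a * -rbs u) / (1 - a)) / (p / (1 - a)))
       = a * (rbK u r (a * u) / p) := by
      rw [hKe, div_div_div_cancel_right₀ ha1', hr]
      field_simp
      ring
    rw [hexp]
    apply mul_nonneg ha0.le
    rcases lt_or_gt_of_ne ha1 with h | h
    · apply div_nonneg (hK.1 _ (by positivity) (by nlinarith))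
      have := mul_pos hP (show 0 < 1 - a by linarith)
      rw [div_mul_cancel₀ _ ha1'] at this
      exact this.le
    · apply div_nonneg_of_nonpos (hK.2 _ (by nlinarith) (by nlinarith))
      have := mul_neg_of_pos_of_neg hP (show 1 - a < 0 by linarith)
      rw [div_mul_cancel₀ _ ha1'] at this
      exact this.le

lemma rb_main (a u : ℝ) (ha0 : 0 < a) (ha2 : a ≤ 2) (ha1 : a ≠ 1) (hu : 0 ≤ u) :
    (rbh (a * u) - a * rbh u) / (1 - a) ≤
      Real.log 2 ^ (1 - a / 2) * (2 * rbh u - rbh (2 * u)) ^ (a / 2) := by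
  have ha1' : 1 - a ≠ 0 := sub_ne_zero.2 (Ne.symm ha1)
  have h := rb_mono a ha0 ha2 ha1 (mem_Ici.2 le_rfl) (mem_Ici.2 hu) hu
  simp only [mul_zero, rbh_zero] at h
  have e1 : 2 * Real.log 2 - Real.log 2 = Real.log 2 := by ring
  have e2 : (Real.log 2 - a * Real.log 2) / (1 - a) = Real.log 2 := by field_simp
  rw [e1, e2] at h
  have hl : 0 < Real.log 2 := Real.log_pos (by norm_num)
  have hQ := rbQ_pos u hu
  have hP := rbP_pos a u ha0 ha1 hu
  rw [← Real.log_le_log_iff hP (by positivity), Real.log_mul (by positivity) (by positivity),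
    Real.log_rpow hl, Real.log_rpow hQ]
  linarith

lemma rb_logs (x : ℝ) (h0 : 1 / 2 ≤ x) (h1 : x < 1) :
    ∃ u, 0 ≤ u ∧ ∀ a, Real.log (x ^ a + (1 - x) ^ a) = rbh (a * u) - a * rbh u := by
  have hx : 0 < x := by linarith
  have hy : 0 < 1 - x := by linarith
  refine ⟨Real.log x - Real.log (1 - x), ?_, ?_⟩
  · have := Real.log_le_log hy (show 1 - x ≤ x by linarith)
    linarith
  · intro a
    have hh : rbh (Real.log x - Real.log (1 - x)) = - Real.log x := by
      unfold rbh
      rw [neg_sub, Real.exp_sub, Real.exp_log hx, Real.exp_log hy, ← Real.log_inv]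
      congr 1
      field_simp
      ring
    rw [hh]
    unfold rbh
    have : x ^ a + (1 - x) ^ a = x ^ a * (1 + Real.exp (-(a * (Real.log x - Real.log (1 - x))))) := by
      rw [Real.rpow_def_of_pos hx, Real.rpow_def_of_pos hy, mul_add, mul_one, ← Real.exp_add]
      congr 2
      ring
    rw [this, Real.log_mul (by positivity) (by positivity), Real.log_rpow hx]
    ring

lemma rb_ne_one (α x : ℝ) (hα0 : 0 < α) (hα2 : α ≤ 2) (h1 : α ≠ 1)
    (hx0 : 1 / 2 ≤ x) (hx1 : x < 1) :
    renyiBin α x ≤ Real.log 2 ^ (1 - α / 2) * (renyiBin 2 x) ^ (α / 2) := by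
  obtain ⟨u, hu, hl⟩ := rb_logs x hx0 hx1
  have := rb_main α u hα0 hα2 h1 hu
  unfold renyiBin
  rw [if_neg h1, if_neg (by norm_num), hl, hl]
  convert this using 3
  ring

lemma rb_half (α x : ℝ) (hα0 : 0 < α) (hα2 : α ≤ 2)
    (hx0 : 1 / 2 ≤ x) (hx1 : x < 1) :
    renyiBin α x ≤ Real.log 2 ^ (1 - α / 2) * (renyiBin 2 x) ^ (α / 2) := by
  by_cases h1 : α = 1
  · subst h1
    have hx : 0 < x := by linarith
    have hy : 0 < 1 - x := by linarith
    have hl : 0 < Real.log 2 := Real.log_pos (by norm_num)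
    have hd : HasDerivAt (fun a : ℝ => Real.log (x ^ a + (1 - x) ^ a))
        (x * Real.log x + (1 - x) * Real.log (1 - x)) 1 := by
      have h : HasDerivAt (fun a : ℝ => Real.log (x ^ a + (1 - x) ^ a)) _ 1 :=
        ((Real.hasStrictDerivAt_const_rpow hx 1).hasDerivAt.add
        (Real.hasStrictDerivAt_const_rpow hy 1).hasDerivAt).log (by simp)
      refine h.congr_deriv ?_
      simp
    have ht := hasDerivAt_iff_tendsto_slope.1 hd
    have ht2 : Tendsto (fun a : ℝ => renyiBin a x) (𝓝[≠] 1) (𝓝 (renyiBin 1 x)) := by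
      have h3 := ht.neg
      have e : renyiBin 1 x = -(x * Real.log x + (1 - x) * Real.log (1 - x)) := by
        simp only [renyiBin, if_true]; ring
      rw [e]
      refine h3.congr' ?_
      filter_upwards [self_mem_nhdsWithin] with a ha
      have ha : a ≠ 1 := ha
      have h4 : a - 1 ≠ 0 := sub_ne_zero.2 ha
      have h5 : 1 - a ≠ 0 := sub_ne_zero.2 (Ne.symm ha)
      simp only [renyiBin, if_neg ha, slope_def_field, Real.rpow_one, add_sub_cancel,
        Real.log_one, sub_zero]
      rw [← div_neg, neg_sub]
    have hQ : 0 < renyiBin 2 x := by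
      obtain ⟨u, hu, hl⟩ := rb_logs x hx0 hx1
      have h := rbQ_pos u hu
      unfold renyiBin
      rw [if_neg (by norm_num), hl]
      apply div_pos_of_neg_of_neg <;> linarith
    have hr : Tendsto (fun a : ℝ => Real.log 2 ^ (1 - a / 2) * (renyiBin 2 x) ^ (a / 2)) (𝓝[≠] 1)
        (𝓝 (Real.log 2 ^ (1 - (1:ℝ) / 2) * (renyiBin 2 x) ^ ((1:ℝ) / 2))) := by
      have hc : Continuous (fun a : ℝ => Real.log 2 ^ (1 - a / 2) * (renyiBin 2 x) ^ (a / 2)) := by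
        apply Continuous.mul
        · exact (Real.continuous_const_rpow hl.ne').comp (by fun_prop)
        · exact (Real.continuous_const_rpow hQ.ne').comp (by fun_prop)
      exact (hc.tendsto 1).mono_left nhdsWithin_le_nhds
    refine le_of_tendsto_of_tendsto ht2 hr ?_
    filter_upwards [self_mem_nhdsWithin,
      mem_nhdsWithin_of_mem_nhds (Ioo_mem_nhds (show (0:ℝ) < 1 by norm_num)
        (show (1:ℝ) < 2 by norm_num))] with a ha hb
    exact rb_ne_one a x hb.1 hb.2.le ha hx0 hx1
  · exact rb_ne_one α x hα0 hα2 h1 hx0 hx1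

lemma rb_at_one (α : ℝ) (hα0 : 0 < α) : renyiBin α 1 = 0 := by
  unfold renyiBin
  split_ifs
  · simp
  · simp [Real.zero_rpow hα0.ne']

lemma rb_symm (α x : ℝ) : renyiBin α (1 - x) = renyiBin α x := by
  unfold renyiBin
  rw [sub_sub_cancel]
  split_ifs
  · ring
  · rw [add_comm]

lemma rb_ge (α x : ℝ) (hα0 : 0 < α) (hα2 : α ≤ 2)
    (hx0 : 1 / 2 ≤ x) (hx1 : x ≤ 1) :
    renyiBin α x ≤ Real.log 2 ^ (1 - α / 2) * (renyiBin 2 x) ^ (α / 2) := by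
  rcases hx1.eq_or_lt with rfl | h
  · rw [rb_at_one α hα0, rb_at_one 2 (by norm_num), Real.zero_rpow (by positivity), mul_zero]
  · exact rb_half α x hα0 hα2 hx0 h

/-- For `0 < α ≤ 2` and `x ∈ [0,1]`, `Hₐᴿ(x) ≤ (ln 2)^(1-α/2) · (H₂ᴿ(x))^(α/2)`. -/
theorem renyi_binary_entropy_upper_bound (α x : ℝ) (hα0 : 0 < α) (hα2 : α ≤ 2)
    (hx0 : 0 ≤ x) (hx1 : x ≤ 1) :
    renyiBin α x ≤ Real.log 2 ^ (1 - α / 2) * (renyiBin 2 x) ^ (α / 2) := by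
  rcases le_total (1 / 2) x with h | h
  · exact rb_ge α x hα0 hα2 h hx1
  · rw [← rb_symm α x, ← rb_symm 2 x]
    exact rb_ge α (1 - x) hα0 hα2 (by linarith) (by linarith)
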